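/- Let n ≥ 1 and let c_0, c_1, …, c_n, c_{n+1} be integers with c_0 = c_{n+1} = 0. Suppose that for all indices 1 ≤ j ≤ i ≤ n one has |(c_{j−1} − c_j) + (c_{i+1} − c_i)| ≤ 2. Then |c_i − c_{i+1}| ≤ 1 for every 0 ≤ i ≤ n; in particular |c_1| ≤ 1 and |c_n| ≤ 1. -/

import Mathlib

/-!
**Statement 7** (the arithmetic Claim in the proof of Theorem `compadm` of
Esteves–Pacini).  Here `c 0, c 1, ..., c n, c (n+1)` are the twister
coefficients `c_{E_0} = 0, c_{E_1}, ..., c_{E_n}, c_{E_{n+1}} = 0` on the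
ordered components of a maximal contracted chain, and the hypothesis says
that the degree `(c_{j-1} - c_j) + (c_{i+1} - c_i)` of the twister on every
subchain `E_j ∪ ... ∪ E_i` has absolute value at most 2.
-/

/-- Integers summing to zero, any two of which differ by at most `2`, are at most `1`. -/
theorem Finset.le_one_of_sum_eq_zero_of_sub_le_two {ι : Type*} {s : Finset ι} {f : ι → ℤ}
    (hsum : ∑ i ∈ s, f i = 0) (hf : ∀ i ∈ s, ∀ j ∈ s, f i - f j ≤ 2) {i : ι} (hi : i ∈ s) :
    f i ≤ 1 := by
  by_contra! hlt
  have hpos : 0 < ∑ j ∈ s, f j :=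
    Finset.sum_pos' (fun j hj => by linarith [hf i hi j hj]) ⟨i, hi, by linarith⟩
  exact hpos.ne' hsum

/-- Integers summing to zero, any two of which differ by at most `2`, have absolute value
at most `1`. -/
theorem Finset.abs_le_one_of_sum_eq_zero_of_sub_le_two {ι : Type*} {s : Finset ι} {f : ι → ℤ}
    (hsum : ∑ i ∈ s, f i = 0) (hf : ∀ i ∈ s, ∀ j ∈ s, f i - f j ≤ 2) {i : ι} (hi : i ∈ s) :
    |f i| ≤ 1 := by
  have hneg : -f i ≤ 1 :=
    Finset.le_one_of_sum_eq_zero_of_sub_le_two (f := fun j => -f j) (by simp [hsum])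
      (fun j hj k hk => by linarith [hf k hk j hj]) hi
  exact abs_le.2 ⟨by linarith, Finset.le_one_of_sum_eq_zero_of_sub_le_two hsum hf hi⟩

/-- Let `n ≥ 1` and `c 0, ..., c (n+1)` be integers with `c 0 = c (n+1) = 0`.
If `|(c (j-1) - c j) + (c (i+1) - c i)| ≤ 2` for all `1 ≤ j ≤ i ≤ n`, then
adjacent coefficients differ by at most 1; in particular `|c 1| ≤ 1` and
`|c n| ≤ 1`. -/
theorem twister_coefficients_claim (n : ℕ) (hn : 1 ≤ n) (c : ℕ → ℤ)
    (hc0 : c 0 = 0) (hcn : c (n + 1) = 0)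
    (h : ∀ i j : ℕ, 1 ≤ j → j ≤ i → i ≤ n →
      |c (j - 1) - c j + (c (i + 1) - c i)| ≤ 2) :
    (∀ i ≤ n, |c i - c (i + 1)| ≤ 1) ∧ |c 1| ≤ 1 ∧ |c n| ≤ 1 := by
  have hsum : ∑ i ∈ Finset.range (n + 1), (c (i + 1) - c i) = 0 := by
    rw [Finset.sum_range_sub, hc0, hcn, sub_zero]
  have hlt : ∀ a b : ℕ, a < b → b ≤ n → |c a - c (a + 1) + (c (b + 1) - c b)| ≤ 2 :=
    fun a b hab hb => h b (a + 1) (Nat.succ_pos a) hab hb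
  have hdiff : ∀ a ∈ Finset.range (n + 1), ∀ b ∈ Finset.range (n + 1),
      (c (a + 1) - c a) - (c (b + 1) - c b) ≤ 2 := by
    intro a ha b hb
    rw [Finset.mem_range] at ha hb
    rcases lt_trichotomy a b with hab | rfl | hab
    · linarith [(abs_le.1 (hlt a b hab (by omega))).1]
    · simp
    · linarith [(abs_le.1 (hlt b a hab (by omega))).2]
  have hadj : ∀ i ≤ n, |c i - c (i + 1)| ≤ 1 := fun i hi => by
    rw [abs_sub_comm]
    exact Finset.abs_le_one_of_sum_eq_zero_of_sub_le_two hsum hdiff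
      (Finset.mem_range.2 (Nat.lt_succ_of_le hi))
  refine ⟨hadj, ?_, ?_⟩
  · simpa [hc0] using hadj 0 (Nat.zero_le n)
  · simpa [hcn] using hadj n le_rfl
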